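/- Let G be a finite strongly connected directed multigraph with M_G = gcd{κ_v : v ∈ V} = 1 (a coEulerian graph). Then the minimal length of a multi-Eulerian tour of G equals U_G = Σ_{v∈V} κ_v d_v, the number of unicycles of G. -/

import Mathlib

open Finset

structure Multigraph (V E : Type) where
  tail : E → V
  head : E → V

namespace Multigraph

variable {V E : Type} [Fintype V] [Fintype E] [DecidableEq V] [DecidableEq E]

/-- Outdegree of a vertex. -/
def outdeg (G : Multigraph V E) (v : V) : ℕ :=
  (Finset.univ.filter (fun e => G.tail e = v)).card

/-- Indegree of a vertex. -/
def indeg (G : Multigraph V E) (v : V) : ℕ :=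
  (Finset.univ.filter (fun e => G.head e = v)).card

/-- Number of edges from `u` to `v`. -/
def edgeCount (G : Multigraph V E) (u v : V) : ℕ :=
  (Finset.univ.filter (fun e => G.tail e = u ∧ G.head e = v)).card

/-- Directed graph Laplacian: `Δ u v = d_v δ_{uv} − d_{vu}`. -/
def laplacian (G : Multigraph V E) : Matrix V V ℤ :=
  fun u v => (if u = v then (G.outdeg v : ℤ) else 0) - (G.edgeCount v u : ℤ)

def Adj (G : Multigraph V E) (u v : V) : Prop := ∃ e, G.tail e = u ∧ G.head e = v

/-- Strong connectivity: every vertex reaches every other by a directed path. -/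
def StronglyConnected (G : Multigraph V E) : Prop :=
  ∀ u v : V, Relation.ReflTransGen G.Adj u v

/-- A list of edges forms a walk: consecutive edges are incident. -/
def IsWalk (G : Multigraph V E) : List E → Prop
  | [] => True
  | [_] => True
  | e :: f :: rest => G.head e = G.tail f ∧ G.IsWalk (f :: rest)

/-- A nonempty walk that returns to its starting vertex. -/
def IsClosedWalk (G : Multigraph V E) (w : List E) : Prop :=
  w ≠ [] ∧ G.IsWalk w ∧ w.getLast?.map G.head = w.head?.map G.tail

/-- The walk starts at vertex `v`. -/
def StartsAt (G : Multigraph V E) (w : List E) (v : V) : Prop :=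
  w.head?.map G.tail = some v

/-- A π-Eulerian tour: closed walk using each edge `e` exactly `π (tail e)` times. -/
def IsPiEulerian (G : Multigraph V E) (π : V → ℕ) (w : List E) : Prop :=
  G.IsClosedWalk w ∧ ∀ e : E, w.count e = π (G.tail e)

/-- An Eulerian tour: closed walk using each edge exactly once. -/
def IsEulerian (G : Multigraph V E) (w : List E) : Prop :=
  G.IsClosedWalk w ∧ ∀ e : E, w.count e = 1

/-- A multi-Eulerian tour: closed walk using each edge at least once, and edges
with the same tail equally often. -/
def IsMultiEulerian (G : Multigraph V E) (w : List E) : Prop :=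
  G.IsClosedWalk w ∧ (∀ e : E, 1 ≤ w.count e) ∧
  ∀ e f : E, G.tail e = G.tail f → w.count e = w.count f

/-- A spanning tree oriented toward `w`: every vertex other than `w` has exactly one
outgoing edge, `w` has none, and every vertex reaches `w` inside the subgraph. -/
def IsTreeTo (G : Multigraph V E) (w : V) (T : Finset E) : Prop :=
  (∀ v, v ≠ w → (T.filter (fun e => G.tail e = v)).card = 1) ∧
  (∀ e ∈ T, G.tail e ≠ w) ∧
  ∀ v : V, Relation.ReflTransGen (fun a b => ∃ e ∈ T, G.tail e = a ∧ G.head e = b) v w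

/-- Number of spanning trees oriented toward `w`. -/
noncomputable def treeCount (G : Multigraph V E) (w : V) : ℕ :=
  Nat.card {T : Finset E // G.IsTreeTo w T}

end Multigraph

namespace Multigraph

section Trees

variable {V E : Type}

/-- `s` selects one outgoing edge at every vertex, and following the selected edges leads from
every vertex to `v`. -/
def IsSectionTo (G : Multigraph V E) (v : V) (s : V → E) : Prop :=
  (∀ u, G.tail (s u) = u) ∧ ∀ u, ∃ k, (fun x => G.head (s x))^[k] u = v

theorem filter_tail_image_erase [Fintype V] [DecidableEq V] [DecidableEq E]
    (G : Multigraph V E) {s : V → E} (hs : ∀ u, G.tail (s u) = u)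
    {v u : V} (hu : u ≠ v) :
    ((univ.erase v).image s).filter (fun e => G.tail e = u) = {s u} := by
  ext e
  simp only [mem_filter, mem_image, mem_erase, mem_univ, and_true, mem_singleton]
  constructor
  · rintro ⟨⟨x, -, rfl⟩, h⟩
    rw [← h, hs]
  · rintro rfl
    exact ⟨⟨u, hu, rfl⟩, hs u⟩

theorem IsSectionTo.isTreeTo [Fintype V] [DecidableEq V] [DecidableEq E]
    {G : Multigraph V E} {v : V} {s : V → E} (hs : G.IsSectionTo v s) :
    G.IsTreeTo v ((univ.erase v).image s) := by
  refine ⟨fun u hu => ?_, fun e he => ?_, fun u => ?_⟩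
  · rw [filter_tail_image_erase G hs.1 hu, card_singleton]
  · obtain ⟨x, hx, rfl⟩ := mem_image.1 he
    rw [hs.1]
    exact (mem_erase.1 hx).1
  · obtain ⟨k, hk⟩ := hs.2 u
    induction k generalizing u with
    | zero => exact hk ▸ .refl
    | succ k ih =>
      by_cases huv : u = v
      · exact huv ▸ .refl
      · exact .head ⟨s u, mem_image_of_mem _ (mem_erase.2 ⟨huv, mem_univ _⟩), hs.1 u, rfl⟩
          (ih _ hk)

theorem IsTreeTo.exists_section [Fintype V] [DecidableEq V] [DecidableEq E]
    {G : Multigraph V E} {e : E} {T : Finset E}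
    (hT : G.IsTreeTo (G.tail e) T) :
    ∃ s, s (G.tail e) = e ∧ G.IsSectionTo (G.tail e) s ∧
      (univ.erase (G.tail e)).image s = T := by
  obtain ⟨h1, h2, h3⟩ := hT
  have hex : ∀ u, ∃ f, (u = G.tail e → f = e) ∧
      (u ≠ G.tail e → T.filter (fun e => G.tail e = u) = {f}) := by
    intro u
    by_cases hu : u = G.tail e
    · exact ⟨e, fun _ => rfl, fun h => absurd hu h⟩
    · obtain ⟨f, hf⟩ := card_eq_one.1 (h1 u hu)
      exact ⟨f, fun h => absurd h hu, fun _ => hf⟩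
  choose s hse hsT using hex
  have hmem : ∀ u, u ≠ G.tail e → s u ∈ T ∧ G.tail (s u) = u := by
    intro u hu
    have : s u ∈ T.filter (fun e => G.tail e = u) := by rw [hsT u hu]; exact mem_singleton_self _
    exact mem_filter.1 this
  have huniq : ∀ f ∈ T, f = s (G.tail f) := by
    intro f hf
    have : f ∈ T.filter (fun e => G.tail e = G.tail f) := mem_filter.2 ⟨hf, rfl⟩
    rw [hsT _ (h2 f hf)] at this
    exact mem_singleton.1 this
  refine ⟨s, hse _ rfl, ⟨fun u => ?_, fun u => ?_⟩, ?_⟩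
  · by_cases hu : u = G.tail e
    · rw [hse u hu, hu]
    · exact (hmem u hu).2
  · induction h3 u using Relation.ReflTransGen.head_induction_on with
    | refl => exact ⟨0, rfl⟩
    | head hab _ ih =>
      obtain ⟨f, hf, rfl, rfl⟩ := hab
      obtain ⟨k, hk⟩ := ih
      refine ⟨k + 1, ?_⟩
      rw [Function.iterate_succ_apply, ← huniq f hf]
      exact hk
  · ext f
    simp only [mem_image, mem_erase, mem_univ, and_true]
    constructor
    · rintro ⟨u, hu, rfl⟩
      exact (hmem u hu).1
    · intro hf
      exact ⟨G.tail f, h2 f hf, (huniq f hf).symm⟩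

open Classical in
theorem treeCount_tail_eq_card [Fintype V] [Fintype E] [DecidableEq V] [DecidableEq E]
    (G : Multigraph V E) (e : E) :
    G.treeCount (G.tail e) =
      #{s : V → E | G.IsSectionTo (G.tail e) s ∧ s (G.tail e) = e} := by
  rw [treeCount, ← Fintype.card_subtype, ← Nat.card_eq_fintype_card]
  symm
  refine Nat.card_eq_of_bijective
    (fun s => ⟨(univ.erase (G.tail e)).image s.1, s.2.1.isTreeTo⟩) ⟨?_, ?_⟩
  · rintro ⟨s, hs, hse⟩ ⟨t, ht, hte⟩ hst
    have hst' : (univ.erase (G.tail e)).image s = (univ.erase (G.tail e)).image t :=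
      congrArg Subtype.val hst
    refine Subtype.ext (funext fun u => ?_)
    change s u = t u
    by_cases hu : u = G.tail e
    · rw [hu, hse, hte]
    · have h := filter_tail_image_erase G hs.1 hu
      rw [hst', filter_tail_image_erase G ht.1 hu] at h
      exact (singleton_injective h).symm
  · rintro ⟨T, hT⟩
    obtain ⟨s, hse, hs, rfl⟩ := hT.exists_section
    exact ⟨⟨s, hs, hse⟩, rfl⟩

theorem _root_.Function.iterate_eq_of_iterate_succ_eq
    {α : Type*} {f : α → α} {x : α} {a b : ℕ}
    (ha : f^[a + 1] x = x) (hb : f^[b + 1] x = x) : f^[a] x = f^[b] x := by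
  have h1 : f^[a + (a + 1) * b] x = f^[a] x := by
    rw [Function.iterate_add_apply]
    congr 1
    exact (Function.IsPeriodicPt.mul_const (show Function.IsPeriodicPt f (a + 1) x from ha) b)
  have h2 : f^[b + (b + 1) * a] x = f^[b] x := by
    rw [Function.iterate_add_apply]
    congr 1
    exact (Function.IsPeriodicPt.mul_const (show Function.IsPeriodicPt f (b + 1) x from hb) a)
  rw [← h1, ← h2]
  congr 1
  ring

/-- In a selection leading to `v`, exactly one of the edges into `v` lies on the cycle. -/
theorem IsSectionTo.existsUnique_edge {G : Multigraph V E} {v : V} {s : V → E}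
    (hs : G.IsSectionTo v s) :
    ∃! e, G.head e = v ∧ G.IsSectionTo (G.tail e) s ∧ s (G.tail e) = e := by
  obtain ⟨k, hk⟩ := hs.2 (G.head (s v))
  set φ : V → V := fun x => G.head (s x) with hφ
  have hper : φ (φ^[k] v) = v := by
    rw [← Function.iterate_succ_apply' φ k v]
    exact hk
  refine ⟨s (φ^[k] v), ⟨hper, ?_, by rw [hs.1]⟩, ?_⟩
  · rw [hs.1]
    refine ⟨hs.1, fun u => ?_⟩
    obtain ⟨j, hj⟩ := hs.2 u
    exact ⟨k + j, by rw [Function.iterate_add_apply, hj]⟩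
  · rintro f ⟨hfv, hf, hfs⟩
    obtain ⟨j, hj⟩ := hf.2 v
    rw [← hfs, ← hj]
    congr 1
    refine Function.iterate_eq_of_iterate_succ_eq (f := φ) ?_ hk
    rw [Function.iterate_succ_apply', hj, hφ]
    change G.head (s (G.tail f)) = v
    rw [hfs, hfv]

theorem IsSectionTo.head {G : Multigraph V E} {e : E} {s : V → E}
    (hs : G.IsSectionTo (G.tail e) s) (hse : s (G.tail e) = e) : G.IsSectionTo (G.head e) s := by
  refine ⟨hs.1, fun u => ?_⟩
  obtain ⟨k, hk⟩ := hs.2 u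
  exact ⟨k + 1, by rw [Function.iterate_succ_apply', hk, hse]⟩

open Classical in
theorem treeCount_mul_outdeg_eq_card [Fintype V] [Fintype E] [DecidableEq V] [DecidableEq E]
    (G : Multigraph V E) (v : V) :
    G.treeCount v * G.outdeg v = #{s : V → E | G.IsSectionTo v s} := by
  rw [card_eq_sum_card_fiberwise (f := fun s => s v) (t := {e | G.tail e = v})
    (fun s hs => by simpa using (mem_filter.1 hs).2.1 v), mul_comm, outdeg, ← smul_eq_mul,
    ← sum_const]
  refine sum_congr rfl fun e he => ?_
  obtain rfl := (mem_filter.1 he).2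
  rw [treeCount_tail_eq_card, filter_filter]

open Classical in
theorem sum_treeCount_tail_eq_card [Fintype V] [Fintype E] [DecidableEq V] [DecidableEq E]
    (G : Multigraph V E) (v : V) :
    ∑ e with G.head e = v, G.treeCount (G.tail e) = #{s : V → E | G.IsSectionTo v s} := by
  simp_rw [treeCount_tail_eq_card, card_filter]
  rw [sum_comm]
  refine sum_congr rfl fun s _ => ?_
  rw [← card_filter, filter_filter]
  split_ifs with h
  · obtain ⟨e, he, huniq⟩ := h.existsUnique_edge
    rw [card_eq_one]
    refine ⟨e, ?_⟩
    ext f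
    simp only [mem_filter, mem_univ, true_and, mem_singleton]
    exact ⟨huniq f, fun h => h ▸ he⟩
  · rw [card_eq_zero, filter_eq_empty_iff]
    rintro e - ⟨rfl, hs, hse⟩
    exact h (hs.head hse)

/-- The tree counts span the kernel of the Laplacian (Markov chain tree theorem). -/
theorem treeCount_mul_outdeg [Fintype V] [Fintype E] [DecidableEq V] [DecidableEq E]
    (G : Multigraph V E) (v : V) :
    G.treeCount v * G.outdeg v = ∑ e with G.head e = v, G.treeCount (G.tail e) := by
  rw [treeCount_mul_outdeg_eq_card, sum_treeCount_tail_eq_card]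

theorem StronglyConnected.treeCount_pos [Fintype V] [Fintype E] [DecidableEq V] [DecidableEq E]
    {G : Multigraph V E} (hsc : G.StronglyConnected)
    (hM : univ.gcd G.treeCount = 1) (v : V) : 0 < G.treeCount v := by
  have hr : ∃ r, G.treeCount r ≠ 0 := by
    by_contra! h
    rw [gcd_eq_zero_iff.2 fun x _ => h x] at hM
    exact zero_ne_one hM
  obtain ⟨r, hr⟩ := hr
  induction hsc r v with
  | refl => exact Nat.pos_of_ne_zero hr
  | tail _ hab ih =>
    obtain ⟨e, rfl, rfl⟩ := hab
    refine Nat.pos_of_mul_pos_right (?_ : 0 < G.treeCount (G.head e) * G.outdeg (G.head e))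
    rw [treeCount_mul_outdeg]
    exact ih.trans_le (single_le_sum (f := fun e => G.treeCount (G.tail e))
      (fun _ _ => Nat.zero_le _) (mem_filter.2 ⟨mem_univ e, rfl⟩))

theorem StronglyConnected.exists_tail_eq {G : Multigraph V E} [Nonempty E]
    (hsc : G.StronglyConnected) (v : V) : ∃ e, G.tail e = v := by
  obtain ⟨e⟩ := ‹Nonempty E›
  rcases (hsc v (G.tail e)).cases_head with h | ⟨u, ⟨f, hf, -⟩, -⟩
  · exact ⟨e, h.symm⟩
  · exact ⟨f, hf⟩

/-- Two balanced weights, one of them positive, on a strongly connected graph are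
proportional. -/
theorem StronglyConnected.exists_mul_eq_mul [Fintype V] [Fintype E] [DecidableEq V]
    {G : Multigraph V E} [Nonempty V]
    (hsc : G.StronglyConnected) {c κ : V → ℕ} (hκ : ∀ v, 0 < κ v)
    (hκb : ∀ v, κ v * G.outdeg v = ∑ e with G.head e = v, κ (G.tail e))
    (hcb : ∀ v, c v * G.outdeg v = ∑ e with G.head e = v, c (G.tail e)) :
    ∃ r, ∀ v, c r * κ v = κ r * c v := by
  obtain ⟨r, hr⟩ := Finite.exists_min (fun v => (c v : ℚ) / κ v)
  have hle : ∀ v, c r * κ v ≤ κ r * c v := by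
    intro v
    have h := hr v
    have h1 : (0 : ℚ) < κ r := by exact_mod_cast hκ r
    have h2 : (0 : ℚ) < κ v := by exact_mod_cast hκ v
    rw [div_le_div_iff₀ h1 h2, mul_comm (c v : ℚ)] at h
    exact_mod_cast h
  refine ⟨r, fun v => ?_⟩
  induction hsc v r using Relation.ReflTransGen.head_induction_on with
  | refl => exact mul_comm _ _
  | head hab _ ih =>
    obtain ⟨e, rfl, rfl⟩ := hab
    have hsum : ∑ f with G.head f = G.head e, c r * κ (G.tail f) =
        ∑ f with G.head f = G.head e, κ r * c (G.tail f) := by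
      rw [← mul_sum, ← mul_sum, ← hκb, ← hcb, ← mul_assoc, ← mul_assoc, ih]
    exact (sum_eq_sum_iff_of_le fun f _ => hle (G.tail f)).1 hsum e
      (mem_filter.2 ⟨mem_univ e, rfl⟩)

end Trees

section Walks

variable {V E : Type}

theorem isWalk_iff_isChain (G : Multigraph V E) (w : List E) :
    G.IsWalk w ↔ w.IsChain (fun e f => G.head e = G.tail f) := by
  induction w with
  | nil => simp [IsWalk]
  | cons e l ih =>
    cases l with
    | nil => simp [IsWalk]
    | cons f l => rw [IsWalk, ih, List.isChain_cons_cons]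

theorem IsClosedWalk.exists_mem_tail_eq {G : Multigraph V E} {w : List E}
    (hw : G.IsClosedWalk w) {e : E} (he : e ∈ w) : ∃ f ∈ w, G.tail f = G.head e := by
  obtain ⟨hne, hch, hcl⟩ := hw
  rw [isWalk_iff_isChain] at hch
  obtain ⟨l₁, l₂, rfl⟩ := List.append_of_mem he
  cases l₂ with
  | nil =>
    cases l₁ with
    | nil => exact ⟨e, by simp, by simpa using hcl.symm⟩
    | cons a l =>
      rw [List.getLast?_concat] at hcl
      exact ⟨a, by simp, by simpa using hcl.symm⟩
  | cons f l =>
    refine ⟨f, by simp, ?_⟩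
    have := (List.isChain_append.1 hch).2.1
    exact (List.isChain_cons_cons.1 this).1.symm

/-- A closed walk can be rotated to start at any visited vertex and then extended by any edge
leaving that vertex. -/
theorem IsClosedWalk.exists_isWalk_perm_cons {G : Multigraph V E} {w : List E}
    (hw : G.IsClosedWalk w) {e f : E} (he : e ∈ w) (hef : G.tail f = G.tail e) :
    ∃ w', G.IsWalk w' ∧ w'.Perm (f :: w) := by
  obtain ⟨hne, hch, hcl⟩ := hw
  rw [isWalk_iff_isChain] at hch
  obtain ⟨l₁, l₂, rfl⟩ := List.append_of_mem he
  obtain ⟨h1, h2, h12⟩ := List.isChain_append.1 hch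
  refine ⟨(e :: l₂) ++ l₁ ++ [f], ?_, ?_⟩
  · rw [isWalk_iff_isChain]
    refine List.isChain_append.2 ⟨List.isChain_append.2 ⟨h2, h1, ?_⟩, by simp, ?_⟩
    · intro x hx y hy
      cases l₁ with
      | nil => simp at hy
      | cons a l =>
        simp only [List.head?_cons, Option.mem_some_iff] at hy
        subst hy
        have hx' : (e :: l₂).getLast? = some x := hx
        rw [List.getLast?_append, hx'] at hcl
        simpa using hcl
    · intro x hx y hy
      simp only [List.head?_cons, Option.mem_some_iff] at hy
      subst hy
      rw [hef]
      rcases List.eq_nil_or_concat l₁ with rfl | ⟨l, a, rfl⟩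
      · have hx' : (e :: l₂).getLast? = some x := by simpa using hx
        simpa [hx'] using hcl
      · have : a = x := by
          rw [List.concat_eq_append, ← List.append_assoc, List.getLast?_concat] at hx
          simpa using hx
        subst this
        exact h12 a (by simp) e (by simp)
  · refine (List.perm_append_comm).trans ?_
    simpa using List.perm_append_comm (l₁ := e :: l₂) (l₂ := l₁)

theorem IsWalk.countP_tail_add [DecidableEq V]
    {G : Multigraph V E} {l : List E} {e : E}
    (hw : G.IsWalk (e :: l)) (v : V) :
    (e :: l).countP (fun f => G.tail f = v) +
        (if G.head ((e :: l).getLast (by simp)) = v then 1 else 0) =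
      (e :: l).countP (fun f => G.head f = v) + (if G.tail e = v then 1 else 0) := by
  induction l generalizing e with
  | nil =>
    by_cases h₁ : G.head e = v <;> by_cases h₂ : G.tail e = v <;> simp [h₁, h₂]
  | cons f l ih =>
    obtain ⟨h, hw⟩ := hw
    have := ih hw
    rw [List.countP_cons, List.countP_cons (a := e), List.getLast_cons (by simp)]
    simp only [decide_eq_true_eq, h]
    omega

theorem _root_.List.sum_filter_count_eq_countP [Fintype E] [DecidableEq E]
    (w : List E) (p : E → Prop) [DecidablePred p] :
    ∑ e with p e, w.count e = w.countP p := by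
  induction w with
  | nil => simp
  | cons a l ih =>
    simp only [List.count_cons, List.countP_cons, sum_add_distrib, ih, beq_iff_eq,
      sum_ite_eq, mem_filter, mem_univ, true_and, decide_eq_true_eq]

theorem _root_.List.sum_count_eq_length_of_fintype [Fintype E] [DecidableEq E]
    (w : List E) : ∑ e, w.count e = w.length := by
  have := List.sum_filter_count_eq_countP w (fun _ => True)
  simpa using this

theorem IsWalk.sum_count_tail_add [Fintype E] [DecidableEq V] [DecidableEq E]
    {G : Multigraph V E} {l : List E} {e : E}
    (hw : G.IsWalk (e :: l)) (v : V) :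
    ∑ f with G.tail f = v, (e :: l).count f +
        (if G.head ((e :: l).getLast (by simp)) = v then 1 else 0) =
      ∑ f with G.head f = v, (e :: l).count f + (if G.tail e = v then 1 else 0) := by
  rw [List.sum_filter_count_eq_countP, List.sum_filter_count_eq_countP]
  exact hw.countP_tail_add v

theorem IsClosedWalk.sum_count_tail [Fintype E] [DecidableEq V] [DecidableEq E]
    {G : Multigraph V E} {w : List E} (hw : G.IsClosedWalk w)
    (v : V) : ∑ f with G.tail f = v, w.count f = ∑ f with G.head f = v, w.count f := by
  obtain ⟨hne, hwalk, hcl⟩ := hw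
  cases w with
  | nil => exact absurd rfl hne
  | cons e l =>
    have h := hwalk.sum_count_tail_add v
    rw [List.getLast?_eq_some_getLast hne] at hcl
    simp only [Option.map_some, List.head?_cons, Option.some.injEq] at hcl
    rw [hcl] at h
    exact Nat.add_right_cancel h

/-- A strongly connected graph with balanced positive edge multiplicities has an Eulerian
tour. -/
theorem StronglyConnected.exists_isClosedWalk_count_eq [Fintype E] [DecidableEq V] [DecidableEq E]
    {G : Multigraph V E} [Nonempty E]
    (hsc : G.StronglyConnected) {m : E → ℕ} (hm : ∀ e, 1 ≤ m e)
    (hb : ∀ v, ∑ e with G.tail e = v, m e = ∑ e with G.head e = v, m e) :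
    ∃ w, G.IsClosedWalk w ∧ ∀ e, w.count e = m e := by
  classical
  let P : ℕ → Prop := fun n => ∃ w, G.IsWalk w ∧ (∀ e, w.count e ≤ m e) ∧ w.length = n
  obtain ⟨e₀⟩ := ‹Nonempty E›
  have hbound : ∀ n, P n → n ≤ ∑ e, m e := by
    rintro n ⟨w, -, hw, rfl⟩
    rw [← List.sum_count_eq_length_of_fintype]
    exact sum_le_sum fun e _ => hw e
  have hP1 : P 1 := by
    refine ⟨[e₀], trivial, fun e => ?_, rfl⟩
    exact (List.count_le_length).trans (hm e)
  obtain ⟨w, hwalk, hwm, hlen⟩ : P (Nat.findGreatest P (∑ e, m e)) :=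
    Nat.findGreatest_spec (hbound 1 hP1) hP1
  have hmax : ∀ w', G.IsWalk w' → (∀ e, w'.count e ≤ m e) → w'.length ≤ w.length := by
    intro w' h1 h2
    rw [hlen]
    exact Nat.le_findGreatest (hbound _ ⟨w', h1, h2, rfl⟩) ⟨w', h1, h2, rfl⟩
  have hext : ∀ f w', G.IsWalk w' → w'.Perm (f :: w) → w.count f = m f := by
    intro f w' hw' hp
    by_contra hne
    have hlt := lt_of_le_of_ne (hwm f) hne
    have h := hmax w' hw' fun e => by
      rw [hp.count_eq, List.count_cons]
      split_ifs with h
      · obtain rfl : f = e := by simpa using h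
        exact hlt
      · exact hwm e
    rw [hp.length_eq, List.length_cons] at h
    omega
  have hne : w ≠ [] := by
    rintro rfl
    have := hmax [e₀] trivial fun e => (List.count_le_length).trans (hm e)
    simp at this
  have hclosed : G.IsClosedWalk w := by
    refine ⟨hne, hwalk, ?_⟩
    cases w with
    | nil => exact absurd rfl hne
    | cons e l =>
      rw [List.getLast?_eq_some_getLast hne]
      simp only [Option.map_some, List.head?_cons, Option.some.injEq]
      have hsat : ∀ f, G.tail f = G.head ((e :: l).getLast hne) →
          (e :: l).count f = m f := by
        intro f hf
        refine hext f (e :: l ++ [f]) ?_ List.perm_append_comm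
        rw [isWalk_iff_isChain] at hwalk ⊢
        refine List.isChain_append.2 ⟨hwalk, by simp, ?_⟩
        intro x hx y hy
        simp only [List.head?_cons, Option.mem_some_iff] at hy
        subst hy
        rw [List.getLast?_eq_some_getLast hne, Option.mem_some_iff] at hx
        rw [← hx, hf]
      by_contra hcl
      have h := hwalk.sum_count_tail_add (G.head ((e :: l).getLast hne))
      rw [if_pos rfl, if_neg (fun h => hcl h.symm),
        sum_congr rfl (fun f hf => hsat f (mem_filter.1 hf).2), hb] at h
      have hle : ∑ f with G.head f = G.head ((e :: l).getLast hne), (e :: l).count f ≤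
          ∑ f with G.head f = G.head ((e :: l).getLast hne), m f :=
        sum_le_sum fun f _ => hwm f
      omega
  refine ⟨w, hclosed, ?_⟩
  have hsat : ∀ e ∈ w, ∀ f, G.tail f = G.tail e → w.count f = m f := by
    intro e he f hf
    obtain ⟨w', h1, h2⟩ := hclosed.exists_isWalk_perm_cons he hf
    exact hext f w' h1 h2
  obtain ⟨a, ha⟩ := List.exists_mem_of_ne_nil w hne
  have hvisit : ∀ v, ∃ e ∈ w, G.tail e = v := by
    intro v
    induction hsc (G.tail a) v with
    | refl => exact ⟨a, ha, rfl⟩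
    | tail _ hab ih =>
      obtain ⟨f, hf, rfl⟩ := hab
      obtain ⟨e, he, hev⟩ := ih
      refine hclosed.exists_mem_tail_eq (List.count_pos_iff.1 ?_)
      rw [hsat e he f (hf.trans hev.symm)]
      exact hm f
  intro f
  obtain ⟨e, he, hef⟩ := hvisit (G.tail f)
  exact hsat e he f hef.symm

theorem sum_filter_tail [Fintype E] [DecidableEq V]
    (G : Multigraph V E) (c : V → ℕ) (v : V) :
    ∑ e with G.tail e = v, c (G.tail e) = c v * G.outdeg v := by
  rw [sum_congr rfl (fun e he => by rw [(mem_filter.1 he).2]), sum_const, outdeg, smul_eq_mul,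
    mul_comm]

theorem length_eq_sum_of_count_eq [Fintype V] [Fintype E] [DecidableEq V] [DecidableEq E]
    (G : Multigraph V E) {w : List E} {c : V → ℕ}
    (hc : ∀ e, w.count e = c (G.tail e)) : w.length = ∑ v, c v * G.outdeg v := by
  rw [← List.sum_count_eq_length_of_fintype, ← sum_fiberwise univ G.tail]
  refine sum_congr rfl fun v _ => ?_
  simp_rw [hc]
  exact G.sum_filter_tail c v

end Walks

end Multigraph

open Multigraph in
theorem stmt17 {V E : Type} [Fintype V] [Fintype E] [DecidableEq V] [DecidableEq E]
    [Nonempty E] (G : Multigraph V E) (hsc : G.StronglyConnected)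
    (hM : Finset.univ.gcd G.treeCount = 1) :
    IsLeast {n : ℕ | ∃ w : List E, G.IsMultiEulerian w ∧ w.length = n}
      (∑ v : V, G.treeCount v * G.outdeg v) := by
  have hpos := hsc.treeCount_pos hM
  constructor
  · obtain ⟨w, hw, hcount⟩ := hsc.exists_isClosedWalk_count_eq
      (m := fun e => G.treeCount (G.tail e)) (fun e => hpos _)
      (fun v => by rw [G.sum_filter_tail, G.treeCount_mul_outdeg])
    refine ⟨w, ⟨hw, fun e => ?_, fun e f hef => ?_⟩, G.length_eq_sum_of_count_eq hcount⟩
    · rw [hcount]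
      exact hpos _
    · rw [hcount, hcount, hef]
  · rintro n ⟨w, ⟨hw, hone, htail⟩, rfl⟩
    choose out hout using hsc.exists_tail_eq
    have hc : ∀ e, w.count e = (fun v => w.count (out v)) (G.tail e) :=
      fun e => htail _ _ (hout _).symm
    have : Nonempty V := ‹Nonempty E›.map G.tail
    obtain ⟨r, hr⟩ := hsc.exists_mul_eq_mul (c := fun v => w.count (out v)) hpos
      G.treeCount_mul_outdeg fun v => by
        rw [← G.sum_filter_tail (fun v => w.count (out v))]
        simp_rw [← hc]
        exact hw.sum_count_tail v
    have hdvd : G.treeCount r ∣ w.count (out r) := by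
      have h : G.treeCount r ∣ univ.gcd fun v => w.count (out r) * G.treeCount v :=
        dvd_gcd fun v _ => ⟨_, hr v⟩
      rw [Finset.gcd_mul_left] at h
      rw [hM] at h
      simpa using h
    have hle := Nat.le_of_dvd (hone _) hdvd
    rw [G.length_eq_sum_of_count_eq (c := fun v => w.count (out v)) hc]
    refine sum_le_sum fun v _ => Nat.mul_le_mul_right _ ?_
    refine Nat.le_of_mul_le_mul_left ?_ (hpos r)
    rw [← hr v]
    exact Nat.mul_le_mul_right _ hle
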